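/- For all σ, τ ∈ S_η one has (1/η!)·∂_{w_η}((∂_τ Δ_η)·(∂_σ Δ_η)) = sym_η(∂_{τ⁻¹}(∂_σ(Δ_η))), and this element satisfies: if ℓ(τ) + ℓ(σ) ≥ ℓ(w_η) then it equals η! when τ⁻¹σ = w_η and 0 otherwise; if ℓ(τ) + ℓ(σ) < ℓ(w_η) then it is an S_η-invariant element of the ideal p_η. -/

import Mathlib

open scoped BigOperators

noncomputable section

namespace GTpaper

variable (r : ℕ) (η : Fin r → ℕ)

/-- The index set Σ(η): pairs (k,i) with 1 ≤ k ≤ r, 1 ≤ i ≤ η_k (0-based). -/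
abbrev Idx := (k : Fin r) × Fin (η k)

/-- The polynomial ring ℂ[X_η]. -/
abbrev Pol := MvPolynomial (Idx r η) ℂ

/-- The field of rational functions F = ℂ(X_η). -/
abbrev FF := FractionRing (Pol r η)

/-- The group S_η = S_{η_1} × ⋯ × S_{η_r}. -/
abbrev Sg := ∀ k : Fin r, Equiv.Perm (Fin (η k))

/-- The action of S_η on the index set. -/
def permIdx (σ : Sg r η) : Equiv.Perm (Idx r η) where
  toFun p := ⟨p.1, σ p.1 p.2⟩
  invFun p := ⟨p.1, (σ p.1)⁻¹ p.2⟩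
  left_inv p := by simp
  right_inv p := by simp

/-- The action of S_η on ℂ[X_η] by permuting variables. -/
def actP (σ : Sg r η) : Pol r η ≃+* Pol r η :=
  (MvPolynomial.renameEquiv ℂ (permIdx r η σ)).toRingEquiv

/-- The action of S_η on F = ℂ(X_η) by field automorphisms. -/
def actF (σ : Sg r η) : FF r η ≃+* FF r η :=
  IsFractionRing.ringEquivOfRingEquiv (actP r η σ)

/-- The variable x_{k,i} viewed as an element of F. -/
def XF (p : Idx r η) : FF r η := algebraMap (Pol r η) (FF r η) (MvPolynomial.X p)

/-- The element of S_η which transposes (k,i) and (k,j) and fixes all other indices. -/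
def transpT (k : Fin r) (i j : Fin (η k)) : Sg r η :=
  Function.update (1 : Sg r η) k (Equiv.swap i j)

/-- The simple transposition s_i^{(k)}. -/
def simpleT (k : Fin r) (i : ℕ) (h : i + 1 < η k) : Sg r η :=
  transpT r η k ⟨i, Nat.lt_of_succ_lt h⟩ ⟨i + 1, h⟩

/-- The divided difference operator ∂_i^{(k)} on F. -/
def dd (k : Fin r) (i : ℕ) (h : i + 1 < η k) (f : FF r η) : FF r η :=
  (f - actF r η (simpleT r η k i h) f) /
    (XF r η ⟨k, ⟨i, Nat.lt_of_succ_lt h⟩⟩ - XF r η ⟨k, ⟨i + 1, h⟩⟩)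

/-- Data indexing a simple transposition of S_η. -/
abbrev SimpleDat := (k : Fin r) × {i : ℕ // i + 1 < η k}

/-- A word in the simple transpositions of S_η. -/
abbrev Word := List (SimpleDat r η)

/-- The element of S_η represented by a word. -/
def wordPerm (w : Word r η) : Sg r η :=
  (w.map fun s => simpleT r η s.1 s.2.1 s.2.2).prod

/-- The composite ∂_{j_1} ∘ ⋯ ∘ ∂_{j_l} of divided differences along a word. -/
def ddWord (w : Word r η) (f : FF r η) : FF r η :=
  w.foldr (fun s g => dd r η s.1 s.2.1 s.2.2 g) f

/-- The length ℓ(σ): the total number of inversions of σ. -/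
def len (σ : Sg r η) : ℕ :=
  ∑ k : Fin r,
    (Finset.univ.filter fun p : Fin (η k) × Fin (η k) => p.1 < p.2 ∧ σ k p.2 < σ k p.1).card

/-- `w` is a reduced decomposition of σ. -/
def IsRed (σ : Sg r η) (w : Word r η) : Prop :=
  wordPerm r η w = σ ∧ w.length = len r η σ

/-- The longest word w_η of S_η. -/
def wEta : Sg r η := fun _ => Fin.revPerm

/-- η! = η_1! ⋯ η_r!. -/
def etaFact : ℕ := ∏ k : Fin r, Nat.factorial (η k)

/-- The Vandermonde-type product Δ_η as a polynomial. -/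
def DeltaP : Pol r η :=
  ∏ k : Fin r, ∏ p ∈ Finset.univ.filter (fun p : Fin (η k) × Fin (η k) => p.1 < p.2),
    (MvPolynomial.X (⟨k, p.1⟩ : Idx r η) - MvPolynomial.X (⟨k, p.2⟩ : Idx r η))

/-- Δ_η as an element of F. -/
def DeltaF : FF r η := algebraMap (Pol r η) (FF r η) (DeltaP r η)

/-- The symmetrization operator sym_η on F. -/
def symF (f : FF r η) : FF r η :=
  (etaFact r η : FF r η)⁻¹ * ∑ σ : Sg r η, actF r η σ f

/-- The sign of an element of S_η. -/
def sgn (σ : Sg r η) : ℤ := ∏ k : Fin r, (Equiv.Perm.sign (σ k) : ℤ)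

/-- The antisymmetrization operator asym_η on F. -/
def asymF (f : FF r η) : FF r η :=
  (etaFact r η : FF r η)⁻¹ * ∑ σ : Sg r η, (sgn r η σ : FF r η) * actF r η σ f

/-- The ideal p_η of ℂ[X_η] generated by the differences x_{k,i} - x_{k,j}. -/
def pIdeal : Ideal (Pol r η) :=
  Ideal.span {q | ∃ (k : Fin r) (i j : Fin (η k)), i < j ∧
    q = MvPolynomial.X (⟨k, i⟩ : Idx r η) - MvPolynomial.X (⟨k, j⟩ : Idx r η)}

section Auxiliary

variable {r η}

/-- The simple transposition attached to a letter. -/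
def letterPerm (s : SimpleDat r η) : Sg r η := simpleT r η s.1 s.2.1 s.2.2

/-- The smaller of the two indices exchanged by a letter. -/
def letterLo (s : SimpleDat r η) : Fin (η s.1) := ⟨s.2.1, Nat.lt_of_succ_lt s.2.2⟩

/-- The larger of the two indices exchanged by a letter. -/
def letterHi (s : SimpleDat r η) : Fin (η s.1) := ⟨s.2.1 + 1, s.2.2⟩

/-- The simple root `x_{k,i} - x_{k,i+1}` attached to a letter. -/
def letterRoot (s : SimpleDat r η) : FF r η :=
  XF r η ⟨s.1, letterLo s⟩ - XF r η ⟨s.1, letterHi s⟩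

lemma letterPerm_self (s : SimpleDat r η) :
    letterPerm s s.1 = Equiv.swap (letterLo s) (letterHi s) := by
  simp [letterPerm, simpleT, transpT, letterLo, letterHi]

lemma letterPerm_of_ne (s : SimpleDat r η) {k : Fin r} (h : k ≠ s.1) : letterPerm s k = 1 := by
  simp [letterPerm, simpleT, transpT, h]

lemma letterLo_lt_letterHi (s : SimpleDat r η) : letterLo s < letterHi s := by
  simp [letterLo, letterHi]

@[simp]
lemma letterPerm_mul_self (s : SimpleDat r η) : letterPerm s * letterPerm s = 1 := by
  funext k
  by_cases h : k = s.1
  · subst h; simp [letterPerm_self]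
  · simp [letterPerm_of_ne s h]

@[simp]
lemma letterPerm_mul_cancel_left (s : SimpleDat r η) (σ : Sg r η) :
    letterPerm s * (letterPerm s * σ) = σ := by
  rw [← mul_assoc, letterPerm_mul_self, one_mul]

@[simp]
lemma letterPerm_inv (s : SimpleDat r η) : (letterPerm s)⁻¹ = letterPerm s :=
  inv_eq_of_mul_eq_one_left (letterPerm_mul_self s)

lemma wordPerm_cons (s : SimpleDat r η) (u : Word r η) :
    wordPerm r η (s :: u) = letterPerm s * wordPerm r η u := by
  simp [wordPerm, letterPerm]

lemma wordPerm_append (u v : Word r η) :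
    wordPerm r η (u ++ v) = wordPerm r η u * wordPerm r η v := by
  simp [wordPerm]

lemma wordPerm_reverse (u : Word r η) : wordPerm r η u.reverse = (wordPerm r η u)⁻¹ := by
  induction u with
  | nil => simp [wordPerm]
  | cons s u ih =>
    rw [List.reverse_cons, wordPerm_append, ih, wordPerm_cons, wordPerm_cons]
    simp [wordPerm]

/-! ### The action on polynomials and rational functions -/

lemma actP_X (σ : Sg r η) (p : Idx r η) :
    actP r η σ (MvPolynomial.X p) = MvPolynomial.X (permIdx r η σ p) := by
  simp [actP]

lemma actP_C (σ : Sg r η) (c : ℂ) : actP r η σ (MvPolynomial.C c) = MvPolynomial.C c := by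
  simp [actP]

lemma actP_mul (σ τ : Sg r η) (q : Pol r η) :
    actP r η (σ * τ) q = actP r η σ (actP r η τ q) := by
  simp only [actP, MvPolynomial.renameEquiv_apply, 
    AlgEquiv.coe_ringEquiv, MvPolynomial.rename_rename]
  rfl

lemma actF_algebraMap (σ : Sg r η) (q : Pol r η) :
    actF r η σ (algebraMap _ _ q) = algebraMap _ _ (actP r η σ q) := by
  simp [actF]

lemma actF_mul (σ τ : Sg r η) (f : FF r η) :
    actF r η (σ * τ) f = actF r η σ (actF r η τ f) := by
  obtain ⟨a, b, hb, rfl⟩ := IsFractionRing.div_surjective (A := Pol r η) f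
  simp only [map_div₀, actF_algebraMap, actP_mul]

lemma actF_one (f : FF r η) : actF r η 1 f = f :=
  (actF r η 1).injective (by rw [← actF_mul, one_mul])

lemma actF_XF (σ : Sg r η) (p : Idx r η) :
    actF r η σ (XF r η p) = XF r η (permIdx r η σ p) := by
  rw [XF, actF_algebraMap, actP_X, XF]

lemma XF_injective : Function.Injective (XF r η) := fun _ _ h =>
  MvPolynomial.X_injective (IsFractionRing.injective (Pol r η) (FF r η) h)

lemma actF_injective : Function.Injective (actF r η) := by
  intro σ τ h
  funext k
  ext i
  have h1 : actF r η σ (XF r η ⟨k, i⟩) = actF r η τ (XF r η ⟨k, i⟩) := by rw [h]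
  rw [actF_XF, actF_XF] at h1
  have h2 := XF_injective h1
  simp only [permIdx, Equiv.coe_fn_mk, Sigma.mk.injEq, heq_eq_eq, true_and] at h2
  rw [h2]

lemma actF_letterPerm_actF_letterPerm (s : SimpleDat r η) (f : FF r η) :
    actF r η (letterPerm s) (actF r η (letterPerm s) f) = f := by
  rw [← actF_mul, letterPerm_mul_self, actF_one]

lemma XF_sub_ne_zero {p q : Idx r η} (h : p ≠ q) : XF r η p - XF r η q ≠ 0 :=
  sub_ne_zero.2 fun e => h (XF_injective e)

lemma letterRoot_ne_zero (s : SimpleDat r η) : letterRoot s ≠ 0 :=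
  XF_sub_ne_zero fun h => (letterLo_lt_letterHi s).ne (by simpa using h)

lemma actF_letterRoot (σ : Sg r η) (s : SimpleDat r η) : actF r η σ (letterRoot s) =
    XF r η ⟨s.1, σ s.1 (letterLo s)⟩ - XF r η ⟨s.1, σ s.1 (letterHi s)⟩ := by
  simp only [letterRoot, map_sub, actF_XF]
  rfl

lemma actF_letterPerm_letterRoot (s : SimpleDat r η) :
    actF r η (letterPerm s) (letterRoot s) = - letterRoot s := by
  rw [actF_letterRoot, letterPerm_self]
  simp [letterRoot]

/-! ### Inversions and lengths -/

/-- Pairs of indices belonging to the same block. -/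
abbrev BlockPair (r : ℕ) (η : Fin r → ℕ) := (k : Fin r) × (Fin (η k) × Fin (η k))

/-- The set of inversions of `σ`. -/
def inversions (σ : Sg r η) : Finset (BlockPair r η) :=
  Finset.univ.sigma fun k =>
    Finset.univ.filter fun p : Fin (η k) × Fin (η k) => p.1 < p.2 ∧ σ k p.2 < σ k p.1

/-- The set of all increasing pairs. -/
def increasingPairs (r : ℕ) (η : Fin r → ℕ) : Finset (BlockPair r η) :=
  Finset.univ.sigma fun k =>
    Finset.univ.filter fun p : Fin (η k) × Fin (η k) => p.1 < p.2

lemma mem_inversions {σ : Sg r η} {k : Fin r} {a b : Fin (η k)} :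
    (⟨k, a, b⟩ : BlockPair r η) ∈ inversions σ ↔ a < b ∧ σ k b < σ k a := by
  simp [inversions]

lemma mem_increasingPairs {k : Fin r} {a b : Fin (η k)} :
    (⟨k, a, b⟩ : BlockPair r η) ∈ increasingPairs r η ↔ a < b := by
  simp [increasingPairs]

lemma len_eq_card (σ : Sg r η) : len r η σ = (inversions σ).card := by
  simp [len, inversions, Finset.card_sigma]

lemma inversions_subset (σ : Sg r η) : inversions σ ⊆ increasingPairs r η := by
  rintro ⟨k, a, b⟩ h
  exact mem_increasingPairs.2 (mem_inversions.1 h).1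

lemma inversions_wEta : inversions (wEta r η) = increasingPairs r η := by
  ext ⟨k, a, b⟩
  simp [mem_inversions, mem_increasingPairs, wEta]

lemma len_one : len r η 1 = 0 := by
  simp only [len_eq_card, Finset.card_eq_zero, Finset.eq_empty_iff_forall_notMem]
  rintro ⟨k, a, b⟩ h
  exact lt_asymm (mem_inversions.1 h).1 (mem_inversions.1 h).2

lemma len_le_len_wEta (σ : Sg r η) : len r η σ ≤ len r η (wEta r η) := by
  rw [len_eq_card, len_eq_card, inversions_wEta]
  exact Finset.card_le_card (inversions_subset σ)

lemma perm_eq_one_of_strictMono {n : ℕ} {π : Equiv.Perm (Fin n)} (h : StrictMono π) : π = 1 := by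
  have := Subsingleton.elim (h.orderIsoOfSurjective π π.surjective) (OrderIso.refl _)
  ext i
  exact congrArg (fun e : Fin n ≃o Fin n => (e i : ℕ)) this

lemma eq_wEta_of_len_eq {σ : Sg r η} (h : len r η σ = len r η (wEta r η)) :
    σ = wEta r η := by
  rw [len_eq_card, len_eq_card, inversions_wEta] at h
  have h' := Finset.eq_of_subset_of_card_le (inversions_subset σ) h.ge
  funext k
  have hm : StrictMono (Fin.revPerm * σ k : Equiv.Perm (Fin (η k))) := by
    intro a b hab
    have := (mem_inversions.1 (h' ▸ mem_increasingPairs.2 hab)).2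
    simpa using this
  have := perm_eq_one_of_strictMono hm
  rw [mul_eq_one_iff_eq_inv'] at this
  rw [this]
  rfl

lemma len_mul_wEta (σ : Sg r η) :
    len r η (σ * wEta r η) + len r η σ = len r η (wEta r η) := by
  have hle := Finset.card_sdiff_add_card_eq_card (inversions_subset σ)
  rw [len_eq_card, len_eq_card, len_eq_card, inversions_wEta, ← hle]
  congr 1
  refine Finset.card_nbij' (fun p => ⟨p.1, p.2.2.rev, p.2.1.rev⟩)
    (fun p => ⟨p.1, p.2.2.rev, p.2.1.rev⟩) ?_ ?_ ?_ ?_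
  · rintro ⟨k, a, b⟩ h
    have h := mem_inversions.1 h
    simp only [wEta, Pi.mul_apply, Equiv.Perm.coe_mul, Function.comp_apply,
      Fin.revPerm_apply] at h
    simp only [Finset.coe_sdiff, Set.mem_sdiff, Finset.mem_coe, mem_inversions,
      mem_increasingPairs, Fin.rev_lt_rev]
    exact ⟨h.1, fun h' => lt_asymm h'.2 h.2⟩
  · rintro ⟨k, a, b⟩ h
    simp only [Finset.coe_sdiff, Set.mem_sdiff, Finset.mem_coe, mem_inversions,
      mem_increasingPairs, not_and, not_lt] at h
    simp only [Finset.mem_coe, mem_inversions, wEta, Pi.mul_apply, Equiv.Perm.coe_mul,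
      Function.comp_apply, Fin.revPerm_apply, Fin.rev_rev, Fin.rev_lt_rev]
    exact ⟨h.1, (h.2 h.1).lt_of_ne fun e => h.1.ne ((σ k).injective e)⟩
  · rintro ⟨k, a, b⟩ -; simp
  · rintro ⟨k, a, b⟩ -; simp

/-- Left multiplication by `s` lengthens `σ`. -/
def IsAscent (s : SimpleDat r η) (σ : Sg r η) : Prop :=
  (σ s.1)⁻¹ (letterLo s) < (σ s.1)⁻¹ (letterHi s)

lemma isAscent_letterPerm_mul {s : SimpleDat r η} {σ : Sg r η} (h : ¬ IsAscent s σ) :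
    IsAscent s (letterPerm s * σ) := by
  simp only [IsAscent, not_lt, Pi.mul_apply, mul_inv_rev, letterPerm_self, Equiv.swap_inv,
    Equiv.Perm.coe_mul, Function.comp_apply, Equiv.swap_apply_left,
    Equiv.swap_apply_right] at h ⊢
  exact h.lt_of_ne fun e => (letterLo_lt_letterHi s).ne' ((σ s.1)⁻¹.injective e)

lemma swap_lt_swap_iff (s : SimpleDat r η) (x y : Fin (η s.1)) :
    Equiv.swap (letterLo s) (letterHi s) y < Equiv.swap (letterLo s) (letterHi s) x ↔
      (x = letterLo s ∧ y = letterHi s) ∨ (y < x ∧ ¬ (y = letterLo s ∧ x = letterHi s)) := by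
  simp only [Equiv.swap_apply_def, Fin.ext_iff, letterLo, letterHi, Fin.lt_def]
  split_ifs <;> (try simp only []) <;> omega

/-- The inversion created by multiplying `σ` on the left by `s`. -/
def newInversion (s : SimpleDat r η) (σ : Sg r η) : BlockPair r η :=
  ⟨s.1, (σ s.1)⁻¹ (letterLo s), (σ s.1)⁻¹ (letterHi s)⟩

lemma newInversion_notMem (s : SimpleDat r η) (σ : Sg r η) :
    newInversion s σ ∉ inversions σ := by
  intro h
  have := (mem_inversions.1 h).2
  simp only [Equiv.Perm.inv_def, Equiv.apply_symm_apply] at this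
  exact lt_asymm this (letterLo_lt_letterHi s)

lemma inversions_letterPerm_mul {s : SimpleDat r η} {σ : Sg r η} (h : IsAscent s σ) :
    inversions (letterPerm s * σ) = insert (newInversion s σ) (inversions σ) := by
  ext ⟨k, a, b⟩
  by_cases hk : k = s.1
  · subst hk
    simp only [Finset.mem_insert, mem_inversions, newInversion, Pi.mul_apply, letterPerm_self,
      Equiv.Perm.coe_mul, Function.comp_apply, Sigma.mk.injEq, heq_eq_eq, true_and,
      Prod.mk.injEq, Equiv.Perm.eq_inv_iff_eq]
    rw [swap_lt_swap_iff]
    constructor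
    · tauto
    · rintro (⟨h1, h2⟩ | ⟨h1, h2⟩)
      · refine ⟨?_, Or.inl ⟨h1, h2⟩⟩
        rwa [IsAscent, ← h1, ← h2, Equiv.Perm.inv_def, Equiv.symm_apply_apply,
          Equiv.symm_apply_apply] at h
      · refine ⟨h1, Or.inr ⟨h2, ?_⟩⟩
        rintro ⟨h3, h4⟩
        rw [IsAscent, ← h3, ← h4, Equiv.Perm.inv_def, Equiv.symm_apply_apply,
          Equiv.symm_apply_apply] at h
        exact lt_asymm h h1
  · have : (⟨k, a, b⟩ : BlockPair r η) ≠ newInversion s σ := fun e =>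
      hk (congrArg Sigma.fst e)
    simp [mem_inversions, letterPerm_of_ne s hk, this]

lemma len_letterPerm_mul {s : SimpleDat r η} {σ : Sg r η} (h : IsAscent s σ) :
    len r η (letterPerm s * σ) = len r η σ + 1 := by
  rw [len_eq_card, len_eq_card, inversions_letterPerm_mul h,
    Finset.card_insert_of_notMem (newInversion_notMem s σ)]

lemma len_letterPerm_mul_add_one {s : SimpleDat r η} {σ : Sg r η} (h : ¬ IsAscent s σ) :
    len r η (letterPerm s * σ) + 1 = len r η σ := by
  rw [← len_letterPerm_mul (isAscent_letterPerm_mul h), letterPerm_mul_cancel_left]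

lemma len_le_len_letterPerm_mul_add_one (s : SimpleDat r η) (σ : Sg r η) :
    len r η σ ≤ len r η (letterPerm s * σ) + 1 := by
  by_cases h : IsAscent s σ
  · have := len_letterPerm_mul h; omega
  · exact (len_letterPerm_mul_add_one h).ge

lemma len_wordPerm_le (u : Word r η) : len r η (wordPerm r η u) ≤ u.length := by
  induction u with
  | nil => simp [wordPerm, len_one]
  | cons s u ih =>
    have := len_le_len_letterPerm_mul_add_one s (letterPerm s * wordPerm r η u)
    rw [letterPerm_mul_cancel_left] at this
    rw [wordPerm_cons, List.length_cons]
    refine le_trans ?_ (Nat.add_le_add_right ih 1)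
    by_cases h : IsAscent s (wordPerm r η u)
    · exact (len_letterPerm_mul h).le
    · have := len_letterPerm_mul_add_one h; omega

lemma perm_eq_one_of_forall_lt_succ {n : ℕ} {π : Equiv.Perm (Fin n)}
    (h : ∀ (i : ℕ) (hi : i + 1 < n), π ⟨i, Nat.lt_of_succ_lt hi⟩ < π ⟨i + 1, hi⟩) : π = 1 := by
  apply perm_eq_one_of_strictMono
  cases n with
  | zero => exact fun a => a.elim0
  | succ n => exact Fin.strictMono_iff_lt_succ.2 fun i => h i (Nat.succ_lt_succ i.2)

lemma eq_one_of_forall_isAscent {σ : Sg r η} (h : ∀ s, IsAscent s σ) : σ = 1 := by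
  funext k
  exact inv_eq_one.1 (perm_eq_one_of_forall_lt_succ fun i hi => h ⟨k, i, hi⟩)

lemma exists_isRed (σ : Sg r η) : ∃ u, IsRed r η σ u := by
  induction hn : len r η σ generalizing σ with
  | zero =>
    refine ⟨[], ?_, hn.symm⟩
    refine (eq_one_of_forall_isAscent fun s => ?_).symm
    by_contra h
    have := len_letterPerm_mul_add_one h
    omega
  | succ n ih =>
    have : ∃ s, ¬ IsAscent s σ := by
      by_contra! h
      rw [eq_one_of_forall_isAscent h, len_one] at hn
      omega
    obtain ⟨s, hs⟩ := this
    have hl := len_letterPerm_mul_add_one hs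
    obtain ⟨u, hu, hu'⟩ := ih (letterPerm s * σ) (by omega)
    refine ⟨s :: u, ?_, ?_⟩
    · rw [wordPerm_cons, hu, letterPerm_mul_cancel_left]
    · rw [List.length_cons, hu', hl]

lemma len_inv_le (σ : Sg r η) : len r η σ⁻¹ ≤ len r η σ := by
  obtain ⟨u, hu, hu'⟩ := exists_isRed σ
  rw [← hu', ← hu, ← wordPerm_reverse, ← List.length_reverse]
  exact len_wordPerm_le _

lemma len_inv (σ : Sg r η) : len r η σ⁻¹ = len r η σ :=
  (len_inv_le σ).antisymm (by simpa using len_inv_le σ⁻¹)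

lemma IsRed.reverse {σ : Sg r η} {u : Word r η} (h : IsRed r η σ u) :
    IsRed r η σ⁻¹ u.reverse :=
  ⟨by rw [wordPerm_reverse, h.1], by rw [List.length_reverse, h.2, len_inv]⟩

/-! ### The action on the Vandermonde product -/

lemma DeltaF_eq_prod : DeltaF r η =
    ∏ p ∈ increasingPairs r η, (XF r η ⟨p.1, p.2.1⟩ - XF r η ⟨p.1, p.2.2⟩) := by
  simp [DeltaF, DeltaP, increasingPairs, Finset.prod_sigma, XF]

lemma DeltaF_ne_zero : DeltaF r η ≠ 0 := by
  rw [DeltaF_eq_prod, Finset.prod_ne_zero_iff]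
  rintro ⟨k, a, b⟩ h
  exact XF_sub_ne_zero fun e => (mem_increasingPairs.1 h).ne (by simpa using e)

lemma actF_letterPerm_DeltaF (s : SimpleDat r η) :
    actF r η (letterPerm s) (DeltaF r η) = - DeltaF r η := by
  have key (σ : Sg r η) (k : Fin r) :
      ∏ p : Fin (η k) × Fin (η k) with p.1 < p.2,
        (XF r η ⟨k, σ k p.1⟩ - XF r η ⟨k, σ k p.2⟩) =
      (Equiv.Perm.sign (σ k) : FF r η) * ∏ p : Fin (η k) × Fin (η k) with p.1 < p.2,
        (XF r η ⟨k, p.1⟩ - XF r η ⟨k, p.2⟩) := by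
    have h (f : Fin (η k) → Fin (η k) → FF r η) :
        ∏ p : Fin (η k) × Fin (η k) with p.1 < p.2, f p.1 p.2 =
          ∏ i, ∏ j ∈ Finset.Ioi i, f i j := by
      rw [Finset.prod_filter, Fintype.prod_prod_type]
      refine Finset.prod_congr rfl fun i _ => ?_
      rw [← Finset.prod_filter]
      exact Finset.prod_congr (by ext; simp) fun _ _ => rfl
    rw [h fun i j => XF r η ⟨k, σ k i⟩ - XF r η ⟨k, σ k j⟩,
      h fun i j => XF r η ⟨k, i⟩ - XF r η ⟨k, j⟩]
    exact (σ k).prod_Ioi_comp_eq_sign_mul_prod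
      (f := fun i j => XF r η ⟨k, i⟩ - XF r η ⟨k, j⟩) fun i j => by ring
  have hprod (σ : Sg r η) : actF r η σ (DeltaF r η) =
      (∏ k, (Equiv.Perm.sign (σ k) : FF r η)) * DeltaF r η := by
    rw [DeltaF_eq_prod, increasingPairs, Finset.prod_sigma, map_prod,
      ← Finset.prod_mul_distrib]
    refine Finset.prod_congr rfl fun k _ => ?_
    rw [← key, map_prod]
    refine Finset.prod_congr rfl fun p _ => ?_
    rw [map_sub, actF_XF, actF_XF]
    rfl
  rw [hprod, Finset.prod_eq_single s.1, letterPerm_self,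
    Equiv.Perm.sign_swap (letterLo_lt_letterHi s).ne]
  · simp
  · intro k _ hk
    simp [letterPerm_of_ne s hk]
  · simp

/-! ### Divided differences -/

lemma ddWord_cons (s : SimpleDat r η) (u : Word r η) (f : FF r η) :
    ddWord r η (s :: u) f =
      (ddWord r η u f - actF r η (letterPerm s) (ddWord r η u f)) / letterRoot s := rfl

lemma ddWord_append (u v : Word r η) (f : FF r η) :
    ddWord r η (u ++ v) f = ddWord r η u (ddWord r η v f) := by
  simp [ddWord]

lemma ddWord_cons_cons_self (s : SimpleDat r η) (u : Word r η) (f : FF r η) :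
    ddWord r η (s :: s :: u) f = 0 := by
  rw [ddWord_cons, ddWord_cons, map_div₀, map_sub, actF_letterPerm_letterRoot,
    actF_letterPerm_actF_letterPerm]
  have := letterRoot_ne_zero s
  field_simp
  ring

/-- The coefficient of `σ` in the expansion of `∂_u` as a sum of the operators
`f ↦ σ (c σ * f)`. -/
def ddCoeff : Word r η → Sg r η → FF r η
  | [], σ => if σ = 1 then 1 else 0
  | s :: u, σ => ddCoeff u σ * actF r η σ⁻¹ (letterRoot s)⁻¹ +
      ddCoeff u (letterPerm s * σ) * actF r η (letterPerm s * σ)⁻¹ (letterRoot s)⁻¹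

lemma actF_actF_inv (σ : Sg r η) (f : FF r η) : actF r η σ (actF r η σ⁻¹ f) = f := by
  rw [← actF_mul, mul_inv_cancel, actF_one]

lemma sum_actF_letterPerm_mul (s : SimpleDat r η) (g : Sg r η → FF r η) :
    ∑ σ, g (letterPerm s * σ) = ∑ σ, g σ :=
  Equiv.sum_comp (Equiv.mulLeft (letterPerm s)) g

lemma ddWord_eq_sum (u : Word r η) (f : FF r η) :
    ddWord r η u f = ∑ σ, actF r η σ (ddCoeff u σ * f) := by
  induction u with
  | nil =>
    rw [Finset.sum_eq_single 1]
    · simp [ddCoeff, ddWord, actF_one]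
    · intro σ _ h; simp [ddCoeff, h]
    · simp
  | cons s u ih =>
    have h1 : ∑ σ, actF r η σ (ddCoeff (s :: u) σ * f) =
        (∑ σ, actF r η σ (ddCoeff u σ * f)) * (letterRoot s)⁻¹ +
        ∑ σ, actF r η σ (ddCoeff u (letterPerm s * σ) *
          actF r η (letterPerm s * σ)⁻¹ (letterRoot s)⁻¹ * f) := by
      rw [Finset.sum_mul, ← Finset.sum_add_distrib]
      refine Finset.sum_congr rfl fun σ _ => ?_
      simp only [ddCoeff, add_mul, map_add, map_mul, actF_actF_inv]
      ring
    have h2 : ∑ σ, actF r η σ (ddCoeff u (letterPerm s * σ) *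
          actF r η (letterPerm s * σ)⁻¹ (letterRoot s)⁻¹ * f) =
        ∑ σ, actF r η (letterPerm s * σ) (ddCoeff u σ * f) *
          actF r η (letterPerm s) (letterRoot s)⁻¹ := by
      rw [← sum_actF_letterPerm_mul s]
      refine Finset.sum_congr rfl fun σ _ => ?_
      rw [letterPerm_mul_cancel_left, mul_right_comm, map_mul]
      simp only [actF_mul, actF_actF_inv]
    rw [h1, h2, ddWord_cons, ih, map_sum, ← Finset.sum_mul]
    have hneg : (-letterRoot s)⁻¹ = -(letterRoot s)⁻¹ := inv_neg
    simp only [actF_mul, map_inv₀, actF_letterPerm_letterRoot, hneg]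
    ring

lemma ddCoeff_eq_zero (u : Word r η) {σ : Sg r η} (h : u.length ≤ len r η σ)
    (hσ : σ ≠ wordPerm r η u) : ddCoeff u σ = 0 := by
  induction u generalizing σ with
  | nil =>
    have : σ ≠ 1 := by simpa [wordPerm] using hσ
    simp [ddCoeff, this]
  | cons s u ih =>
    rw [List.length_cons] at h
    rw [ddCoeff, ih (by omega), ih, zero_mul, zero_mul, add_zero]
    · have := len_le_len_letterPerm_mul_add_one s σ
      omega
    · rintro e
      rw [wordPerm_cons, ← e, letterPerm_mul_cancel_left] at hσ
      exact hσ rfl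
    · rintro rfl
      have := len_wordPerm_le u
      omega

lemma ddCoeff_wordPerm (u : Word r η) (h : len r η (wordPerm r η u) = u.length) :
    ddCoeff u (wordPerm r η u) = ∏ p ∈ inversions (wordPerm r η u),
      (XF r η ⟨p.1, p.2.1⟩ - XF r η ⟨p.1, p.2.2⟩)⁻¹ := by
  induction u with
  | nil =>
    have : inversions (wordPerm r η []) = ∅ := by
      rw [← Finset.card_eq_zero, ← len_eq_card, h, List.length_nil]
    rw [this]
    simp [ddCoeff, wordPerm]
  | cons s u ih =>
    have hle := len_wordPerm_le u
    rw [wordPerm_cons, List.length_cons] at h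
    have hasc : IsAscent s (wordPerm r η u) := by
      by_contra hs
      have := len_letterPerm_mul_add_one hs
      omega
    have hlen := len_letterPerm_mul hasc
    rw [wordPerm_cons, ddCoeff, letterPerm_mul_cancel_left, ih (by omega),
      inversions_letterPerm_mul hasc, Finset.prod_insert (newInversion_notMem s _),
      ddCoeff_eq_zero u (by omega), zero_mul, zero_add, mul_comm, map_inv₀, actF_letterRoot]
    · rfl
    · intro e
      rw [e] at h
      omega

/-- Dedekind's independence of the automorphisms `σ`. -/
lemma eq_of_sum_actF_eq {c d : Sg r η → FF r η}
    (h : ∀ f, ∑ σ, actF r η σ (c σ * f) = ∑ σ, actF r η σ (d σ * f)) : c = d := by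
  have hli := (linearIndependent_monoidHom (FF r η) (FF r η)).comp
    (fun σ : Sg r η => ((actF r η σ : FF r η →+* FF r η) : FF r η →* FF r η))
    (fun σ τ e => actF_injective (RingEquiv.ext fun f => DFunLike.congr_fun e f))
  rw [Fintype.linearIndependent_iff] at hli
  funext σ
  have := hli (fun σ => actF r η σ (c σ) - actF r η σ (d σ)) (by
    funext f
    have hf := h f
    simp only [map_mul] at hf
    simp only [Function.comp_apply, Finset.sum_apply, Pi.smul_apply, smul_eq_mul, Pi.zero_apply,
      sub_mul, Finset.sum_sub_distrib, sub_eq_zero]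
    exact hf) σ
  exact (actF r η σ).injective (sub_eq_zero.1 this)

/-! ### The divided difference of the longest element -/

lemma ddWord_eq_zero {Pd : Sg r η → FF r η → FF r η}
    (hPd : ∀ (σ : Sg r η) (w : Word r η), IsRed r η σ w → ∀ f, Pd σ f = ddWord r η w f)
    {u : Word r η} (h : len r η (wordPerm r η u) < u.length) (f : FF r η) :
    ddWord r η u f = 0 := by
  induction u with
  | nil => simp at h
  | cons s u ih =>
    rcases (len_wordPerm_le u).lt_or_eq with hu | hu
    · simp [ddWord_cons, ih hu]
    · rw [wordPerm_cons, List.length_cons] at h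
      have hs : ¬ IsAscent s (wordPerm r η u) := fun hs => by
        have := len_letterPerm_mul hs
        omega
      obtain ⟨v, hv, hv'⟩ := exists_isRed (letterPerm s * wordPerm r η u)
      have hsv : IsRed r η (wordPerm r η u) (s :: v) :=
        ⟨by rw [wordPerm_cons, hv, letterPerm_mul_cancel_left],
          by rw [List.length_cons, hv', len_letterPerm_mul_add_one hs]⟩
      rw [ddWord_cons, ← hPd _ u ⟨rfl, hu.symm⟩, hPd _ _ hsv, ← ddWord_cons,
        ddWord_cons_cons_self]

lemma actF_letterPerm_ddWord_longest {Pd : Sg r η → FF r η → FF r η}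
    (hPd : ∀ (σ : Sg r η) (w : Word r η), IsRed r η σ w → ∀ f, Pd σ f = ddWord r η w f)
    {u : Word r η} (hu : IsRed r η (wEta r η) u) (s : SimpleDat r η) (f : FF r η) :
    actF r η (letterPerm s) (ddWord r η u f) = ddWord r η u f := by
  have h : ddWord r η (s :: u) f = 0 := ddWord_eq_zero hPd (by
    rw [List.length_cons, hu.2]
    exact Nat.lt_succ_of_le (len_le_len_wEta _)) f
  rw [ddWord_cons, div_eq_zero_iff, or_iff_left (letterRoot_ne_zero s), sub_eq_zero] at h
  exact h.symm

lemma ddCoeff_longest {Pd : Sg r η → FF r η → FF r η}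
    (hPd : ∀ (σ : Sg r η) (w : Word r η), IsRed r η σ w → ∀ f, Pd σ f = ddWord r η w f)
    {u : Word r η} (hu : IsRed r η (wEta r η) u) (σ : Sg r η) :
    ddCoeff u σ = (DeltaF r η)⁻¹ := by
  have hs (s : SimpleDat r η) (σ : Sg r η) : ddCoeff u (letterPerm s * σ) = ddCoeff u σ := by
    refine congrFun (eq_of_sum_actF_eq (c := fun σ => ddCoeff u (letterPerm s * σ))
      (d := ddCoeff u) fun f => ?_) σ
    rw [← ddWord_eq_sum, ← actF_letterPerm_ddWord_longest hPd hu s, ddWord_eq_sum, map_sum,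
      ← sum_actF_letterPerm_mul s]
    exact Finset.sum_congr rfl fun σ _ => by
      rw [letterPerm_mul_cancel_left, actF_mul]
  have hv (v : Word r η) (σ : Sg r η) : ddCoeff u (wordPerm r η v * σ) = ddCoeff u σ := by
    induction v with
    | nil => simp [wordPerm]
    | cons s v ih => rw [wordPerm_cons, mul_assoc, hs, ih]
  obtain ⟨v, hv', -⟩ := exists_isRed (σ * (wEta r η)⁻¹)
  have h := hv v (wEta r η)
  rw [hv', inv_mul_cancel_right] at h
  have hlead := ddCoeff_wordPerm u (by rw [hu.1, hu.2])
  rw [hu.1] at hlead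
  rw [h, hlead, inversions_wEta, DeltaF_eq_prod, Finset.prod_inv_distrib]

lemma ddWord_longest {Pd : Sg r η → FF r η → FF r η}
    (hPd : ∀ (σ : Sg r η) (w : Word r η), IsRed r η σ w → ∀ f, Pd σ f = ddWord r η w f)
    {u : Word r η} (hu : IsRed r η (wEta r η) u) (f : FF r η) :
    ddWord r η u f = ∑ σ, actF r η σ ((DeltaF r η)⁻¹ * f) := by
  simp only [ddWord_eq_sum, ddCoeff_longest hPd hu]

lemma sum_actF_letter_adjoint (s : SimpleDat r η) (f g : FF r η) :
    ∑ σ, actF r η σ ((DeltaF r η)⁻¹ *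
      ((f - actF r η (letterPerm s) f) / letterRoot s * g)) =
    ∑ σ, actF r η σ ((DeltaF r η)⁻¹ *
      (f * ((g - actF r η (letterPerm s) g) / letterRoot s))) := by
  have hanti (k : FF r η) (hk : actF r η (letterPerm s) k = -k) :
      ∑ σ, actF r η σ k = 0 := by
    have h : ∑ σ, actF r η σ k = - ∑ σ, actF r η σ k := by
      conv_lhs => rw [← Equiv.sum_comp (Equiv.mulRight (letterPerm s))]
      simp [actF_mul, hk]
    exact self_eq_neg.1 h
  rw [← sub_eq_zero, ← Finset.sum_sub_distrib]
  simp only [← map_sub]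
  apply hanti
  simp only [map_sub, map_mul, map_inv₀, map_div₀, actF_letterPerm_DeltaF,
    actF_letterPerm_letterRoot, actF_letterPerm_actF_letterPerm]
  have := letterRoot_ne_zero s
  have := DeltaF_ne_zero (r := r) (η := η)
  field_simp
  ring

lemma sum_actF_ddWord_adjoint (u : Word r η) (f g : FF r η) :
    ∑ σ, actF r η σ ((DeltaF r η)⁻¹ * (ddWord r η u f * g)) =
      ∑ σ, actF r η σ ((DeltaF r η)⁻¹ * (f * ddWord r η u.reverse g)) := by
  induction u generalizing g with
  | nil => rfl
  | cons s u ih =>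
    rw [ddWord_cons, sum_actF_letter_adjoint, ih, List.reverse_cons, ddWord_append]
    rfl

lemma card_Sg : Fintype.card (Sg r η) = etaFact r η := by
  simp [etaFact, Fintype.card_pi, Fintype.card_perm]

lemma etaFact_ne_zero : (etaFact r η : FF r η) ≠ 0 := by
  rw [Nat.cast_ne_zero, ← card_Sg]
  exact Fintype.card_ne_zero

lemma symF_natCast (n : ℕ) : symF r η n = n := by
  have := etaFact_ne_zero (r := r) (η := η)
  simp only [symF, map_natCast, Finset.sum_const, Finset.card_univ, card_Sg, nsmul_eq_mul]
  field_simp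

lemma ddWord_longest_DeltaF {Pd : Sg r η → FF r η → FF r η}
    (hPd : ∀ (σ : Sg r η) (w : Word r η), IsRed r η σ w → ∀ f, Pd σ f = ddWord r η w f)
    {u : Word r η} (hu : IsRed r η (wEta r η) u) :
    ddWord r η u (DeltaF r η) = etaFact r η := by
  rw [ddWord_longest hPd hu, inv_mul_cancel₀ DeltaF_ne_zero]
  simp only [map_one, Finset.sum_const, Finset.card_univ, card_Sg, nsmul_eq_mul, mul_one]

/-! ### Powers of the ideal `p_η` -/

lemma X_sub_X_mem_pIdeal (k : Fin r) (i j : Fin (η k)) :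
    (MvPolynomial.X (⟨k, i⟩ : Idx r η) - MvPolynomial.X (⟨k, j⟩ : Idx r η) : Pol r η) ∈
      pIdeal r η := by
  rcases lt_trichotomy i j with h | rfl | h
  · exact Ideal.subset_span ⟨k, i, j, h, rfl⟩
  · simp
  · rw [← neg_sub]
    exact neg_mem (Ideal.subset_span ⟨k, j, i, h, rfl⟩)

lemma map_actP_pIdeal_le (σ : Sg r η) : (pIdeal r η).map (actP r η σ) ≤ pIdeal r η := by
  refine Ideal.map_le_iff_le_comap.2 (Ideal.span_le.2 ?_)
  rintro _ ⟨k, i, j, -, rfl⟩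
  change actP r η σ _ ∈ pIdeal r η
  rw [map_sub, actP_X, actP_X]
  exact X_sub_X_mem_pIdeal k _ _

lemma actP_mem_pIdeal_pow (σ : Sg r η) {n : ℕ} {q : Pol r η} (hq : q ∈ pIdeal r η ^ n) :
    actP r η σ q ∈ pIdeal r η ^ n := by
  have h := Ideal.mem_map_of_mem (actP r η σ) hq
  rw [Ideal.map_pow] at h
  exact Ideal.pow_right_mono (map_actP_pIdeal_le σ) n h

/-- The simple root of a letter, as a polynomial. -/
def letterRootP (s : SimpleDat r η) : Pol r η :=
  MvPolynomial.X ⟨s.1, letterLo s⟩ - MvPolynomial.X ⟨s.1, letterHi s⟩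

lemma algebraMap_letterRootP (s : SimpleDat r η) :
    algebraMap (Pol r η) (FF r η) (letterRootP s) = letterRoot s := by
  simp [letterRootP, letterRoot, XF]

lemma letterRootP_dvd_X_sub (s : SimpleDat r η) (p : Idx r η) :
    letterRootP s ∣ MvPolynomial.X p - actP r η (letterPerm s) (MvPolynomial.X p) := by
  obtain ⟨k, i⟩ := p
  rw [actP_X]
  change letterRootP s ∣ MvPolynomial.X (⟨k, i⟩ : Idx r η) -
    MvPolynomial.X (⟨k, letterPerm s k i⟩ : Idx r η)
  by_cases hk : k = s.1
  · subst hk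
    rw [letterPerm_self]
    by_cases hlo : i = letterLo s
    · rw [hlo, Equiv.swap_apply_left]
      exact dvd_rfl
    by_cases hhi : i = letterHi s
    · rw [hhi, Equiv.swap_apply_right, ← neg_sub, dvd_neg]
      exact dvd_rfl
    · rw [Equiv.swap_apply_of_ne_of_ne hlo hhi, sub_self]
      exact dvd_zero _
  · simp [letterPerm_of_ne s hk]

lemma letterRootP_dvd_sub (s : SimpleDat r η) (q : Pol r η) :
    letterRootP s ∣ q - actP r η (letterPerm s) q := by
  induction q using MvPolynomial.induction_on with
  | C c => simp [actP_C]
  | add f g hf hg =>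
    rw [map_add, add_sub_add_comm]
    exact dvd_add hf hg
  | mul_X f p hf =>
    have : f * MvPolynomial.X p - actP r η (letterPerm s) (f * MvPolynomial.X p) =
        (f - actP r η (letterPerm s) f) * MvPolynomial.X p + actP r η (letterPerm s) f *
          (MvPolynomial.X p - actP r η (letterPerm s) (MvPolynomial.X p)) := by
      rw [map_mul]
      ring
    rw [this]
    exact dvd_add (hf.mul_right _) ((letterRootP_dvd_X_sub s p).mul_left _)

lemma exists_mem_pIdeal_pow (s : SimpleDat r η) (n : ℕ) {q : Pol r η}
    (hq : q ∈ pIdeal r η ^ (n + 1)) :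
    ∃ q' ∈ pIdeal r η ^ n, q - actP r η (letterPerm s) q = letterRootP s * q' := by
  induction n generalizing q with
  | zero =>
    obtain ⟨q', h⟩ := letterRootP_dvd_sub s q
    exact ⟨q', by simp, h⟩
  | succ n ih =>
    rw [pow_succ] at hq
    induction hq using Submodule.mul_induction_on' with
    | mem_mul_mem a ha b hb =>
      obtain ⟨a', ha', hae⟩ := ih ha
      obtain ⟨b', hbe⟩ := letterRootP_dvd_sub s b
      refine ⟨a' * b + actP r η (letterPerm s) a * b', add_mem ?_ ?_, ?_⟩
      · rw [pow_succ]
        exact Ideal.mul_mem_mul ha' hb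
      · exact Ideal.mul_mem_right _ _ (actP_mem_pIdeal_pow _ ha)
      · rw [map_mul]
        linear_combination b * hae + actP r η (letterPerm s) a * hbe
    | add a _ b _ iha ihb =>
      obtain ⟨a', ha', hae⟩ := iha
      obtain ⟨b', hb', hbe⟩ := ihb
      refine ⟨a' + b', add_mem ha' hb', ?_⟩
      rw [map_add]
      linear_combination hae + hbe

lemma ddWord_mem_pIdeal_pow (u : Word r η) {n : ℕ} {q : Pol r η}
    (hq : q ∈ pIdeal r η ^ (n + u.length)) :
    ∃ q' ∈ pIdeal r η ^ n, ddWord r η u (algebraMap _ _ q) = algebraMap _ _ q' := by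
  induction u generalizing n with
  | nil => exact ⟨q, hq, rfl⟩
  | cons s u ih =>
    obtain ⟨a, ha, hae⟩ := ih (n := n + 1) (by rwa [add_assoc, add_comm 1])
    obtain ⟨b, hb, hbe⟩ := exists_mem_pIdeal_pow s n ha
    refine ⟨b, hb, ?_⟩
    rw [ddWord_cons, hae, actF_algebraMap, ← map_sub, hbe, map_mul, algebraMap_letterRootP,
      mul_div_cancel_left₀ _ (letterRoot_ne_zero s)]

lemma DeltaP_mem : DeltaP r η ∈ pIdeal r η ^ len r η (wEta r η) := by
  have h : DeltaP r η = ∏ p ∈ increasingPairs r η,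
      (MvPolynomial.X (⟨p.1, p.2.1⟩ : Idx r η) - MvPolynomial.X ⟨p.1, p.2.2⟩) := by
    rw [increasingPairs, Finset.prod_sigma, DeltaP]
  rw [h, len_eq_card, inversions_wEta, ← Finset.prod_const]
  exact Ideal.prod_mem_prod fun p _ => X_sub_X_mem_pIdeal _ _ _

lemma exists_symF_algebraMap {q : Pol r η} (hq : q ∈ pIdeal r η) :
    ∃ q' ∈ pIdeal r η, (∀ ρ : Sg r η, actP r η ρ q' = q') ∧
      symF r η (algebraMap _ _ q) = algebraMap _ _ q' := by
  refine ⟨MvPolynomial.C (etaFact r η : ℂ)⁻¹ * ∑ σ, actP r η σ q, ?_, fun ρ => ?_, ?_⟩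
  · refine Ideal.mul_mem_left _ _ (sum_mem fun σ _ => ?_)
    simpa using actP_mem_pIdeal_pow σ (n := 1) (by simpa using hq)
  · rw [map_mul, actP_C, map_sum, ← Equiv.sum_comp (Equiv.mulLeft ρ) fun σ => actP r η σ q]
    simp [actP_mul]
  · have h0 : (etaFact r η : ℂ) ≠ 0 := by
      rw [Nat.cast_ne_zero, ← card_Sg]
      exact Fintype.card_ne_zero
    have h : algebraMap (Pol r η) (FF r η) (MvPolynomial.C (etaFact r η : ℂ)⁻¹) =
        (etaFact r η : FF r η)⁻¹ := by
      apply eq_inv_of_mul_eq_one_left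
      rw [← map_natCast (algebraMap (Pol r η) (FF r η)), ← map_mul,
        ← map_natCast (MvPolynomial.C (R := ℂ) (σ := Idx r η)), ← map_mul,
        inv_mul_cancel₀ h0, map_one, map_one]
    simp only [symF, map_mul, map_sum, actF_algebraMap, h]

end Auxiliary

/-- (1/η!)·∂_{w_η}((∂_τ Δ_η)·(∂_σ Δ_η)) = sym_η(∂_{τ⁻¹}(∂_σ(Δ_η))); if
ℓ(τ) + ℓ(σ) ≥ ℓ(w_η) this equals η! when τ⁻¹σ = w_η and 0 otherwise, and if
ℓ(τ) + ℓ(σ) < ℓ(w_η) it is an S_η-invariant element of the ideal p_η. -/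
theorem statement9 (m r : ℕ) (η : Fin r → ℕ) (hpos : ∀ k, 0 < η k) (hsum : ∑ k, η k = m)
    (Pd : Sg r η → FF r η → FF r η)
    (hPd : ∀ (σ : Sg r η) (w : Word r η), IsRed r η σ w → ∀ f, Pd σ f = ddWord r η w f) :
    ∀ σ τ : Sg r η,
      (etaFact r η : FF r η)⁻¹ * Pd (wEta r η) (Pd τ (DeltaF r η) * Pd σ (DeltaF r η)) =
        symF r η (Pd τ⁻¹ (Pd σ (DeltaF r η))) ∧
      (len r η τ + len r η σ ≥ len r η (wEta r η) →
        (τ⁻¹ * σ = wEta r η →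
          symF r η (Pd τ⁻¹ (Pd σ (DeltaF r η))) = (etaFact r η : FF r η)) ∧
        (τ⁻¹ * σ ≠ wEta r η → symF r η (Pd τ⁻¹ (Pd σ (DeltaF r η))) = 0)) ∧
      (len r η τ + len r η σ < len r η (wEta r η) →
        ∃ q ∈ pIdeal r η, (∀ ρ : Sg r η, actP r η ρ q = q) ∧
          symF r η (Pd τ⁻¹ (Pd σ (DeltaF r η))) = algebraMap (Pol r η) (FF r η) q) := by
  intro σ τ
  obtain ⟨w, hw⟩ := exists_isRed (wEta r η)
  obtain ⟨u, hu⟩ := exists_isRed σ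
  obtain ⟨v, hv⟩ := exists_isRed τ
  have hcomp : Pd τ⁻¹ (Pd σ (DeltaF r η)) = ddWord r η (v.reverse ++ u) (DeltaF r η) := by
    rw [hPd _ _ hu, hPd _ _ hv.reverse, ddWord_append]
  have hperm : wordPerm r η (v.reverse ++ u) = τ⁻¹ * σ := by
    rw [wordPerm_append, hv.reverse.1, hu.1]
  have hlength : (v.reverse ++ u).length = len r η τ + len r η σ := by
    rw [List.length_append, List.length_reverse, hv.2, hu.2]
  refine ⟨?_, fun hge => ⟨fun heq => ?_, fun hne => ?_⟩, fun hlt => ?_⟩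
  · rw [hcomp, hPd _ _ hw, hPd _ _ hu, hPd _ _ hv, ddWord_longest hPd hw,
      sum_actF_ddWord_adjoint, ddWord_append, symF]
    simp only [inv_mul_cancel_left₀ DeltaF_ne_zero]
  · have hlen := len_mul_wEta τ
    rw [← heq, mul_inv_cancel_left] at hlen
    rw [hcomp, ddWord_longest_DeltaF hPd ⟨by rw [hperm, heq], by
      rw [hlength, ← heq]; omega⟩, symF_natCast]
  · have hle := len_wordPerm_le (v.reverse ++ u)
    have hmax := len_le_len_wEta (τ⁻¹ * σ)
    rw [hperm, hlength] at hle
    have hlt : len r η (τ⁻¹ * σ) < len r η (wEta r η) :=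
      hmax.lt_of_ne fun e => hne (eq_wEta_of_len_eq e)
    rw [hcomp, ddWord_eq_zero hPd (by rw [hperm, hlength]; omega)]
    simpa using symF_natCast (r := r) (η := η) 0
  · obtain ⟨q, hq, hqe⟩ := ddWord_mem_pIdeal_pow (v.reverse ++ u)
      (n := len r η (wEta r η) - (len r η τ + len r η σ)) (q := DeltaP r η) (by
        rw [hlength, Nat.sub_add_cancel hlt.le]
        exact DeltaP_mem)
    rw [hcomp, DeltaF, hqe]
    exact exists_symF_algebraMap (Ideal.pow_le_self (Nat.sub_pos_of_lt hlt).ne' hq)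

end GTpaper

end
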